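/- Let α₁, α₂ ∈ ℝ with α₁ ≠ 0 and 2α₂/(3α₁) ∉ ℤ. Then there exists a constant C > 0, depending only on α₁ and α₂, such that for every k ∈ ℤ and every triple (k₁,k₂,k₃) ∈ D₂(k), one has |Φ(k₁,k₂,k₃)|^{−1} ≤ C·(max{⟨k₁⟩, ⟨k₂⟩, ⟨k₃⟩})^{−2}·(⟨k₁+k₂⟩^{−1} + ⟨k₁+k₃⟩^{−1} + ⟨k₂+k₃⟩^{−1}). -/

import Mathlib

open scoped ENNReal

/-- Japanese bracket `⟨x⟩ = 1 + |x|`. -/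
noncomputable def jap (x : ℝ) : ℝ := 1 + |x|

/-- The resonance function `Φ(k₁,k₂,k₃)` of the third order dispersion
relation `k ↦ α₁k³ + α₂k²`. -/
noncomputable def resPhi (α₁ α₂ : ℝ) (k₁ k₂ k₃ : ℤ) : ℝ :=
  (α₁ * ((k₁ : ℝ) + k₂ + k₃) ^ 3 + α₂ * ((k₁ : ℝ) + k₂ + k₃) ^ 2) -
    (α₁ * (k₁ : ℝ) ^ 3 + α₂ * (k₁ : ℝ) ^ 2) +
    (α₁ * (-(k₂ : ℝ)) ^ 3 + α₂ * (-(k₂ : ℝ)) ^ 2) -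
    (α₁ * (k₃ : ℝ) ^ 3 + α₂ * (k₃ : ℝ) ^ 2)

/-- Membership in the region `D₂(k)` (with `k = k₁+k₂+k₃` implicit): nonresonant triples
that are not frequency-balanced. -/
def memD2 (k₁ k₂ k₃ : ℤ) : Prop :=
  (k₁ + k₂) * (k₂ + k₃) ≠ 0 ∧
    ¬((|k₂| ≤ 4 * |k₁| ∧ |k₁| ≤ 4 * |k₂|) ∧ (|k₂| ≤ 4 * |k₃| ∧ |k₃| ≤ 4 * |k₂|))

theorem resPhi_eq_mul {α₁ : ℝ} (α₂ : ℝ) (hα₁ : α₁ ≠ 0) (k₁ k₂ k₃ : ℤ) :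
    resPhi α₁ α₂ k₁ k₂ k₃ =
      3 * α₁ * ((k₁ : ℝ) + k₂) * ((k₂ : ℝ) + k₃) * ((k₁ : ℝ) + k₃ + 2 * α₂ / (3 * α₁)) := by
  unfold resPhi
  field_simp
  ring

theorem jap_pos (x : ℝ) : 0 < jap x := by
  unfold jap
  positivity

/-- Integer translates of a non-integer `γ` are bounded below by a multiple of the bracket. -/
theorem exists_mul_jap_le_abs_add {γ : ℝ} (hγ : ∀ n : ℤ, γ ≠ n) :
    ∃ δ : ℝ, 0 < δ ∧ ∀ n : ℤ, δ * jap n ≤ |(n : ℝ) + γ| := by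
  have hd : 0 < |γ - round γ| := abs_pos.mpr (sub_ne_zero.mpr (hγ _))
  set d := |γ - round γ| with hd_def
  refine ⟨d / (1 + |γ| + d), by positivity, fun n => ?_⟩
  have h1 : d ≤ |(n : ℝ) + γ| := by
    have h := round_le γ (-n)
    rw [← hd_def] at h
    refine h.trans_eq ?_
    push_cast
    ring_nf
  have h2 : |(n : ℝ)| ≤ |(n : ℝ) + γ| + |γ| := by
    simpa using abs_sub ((n : ℝ) + γ) γ
  rw [div_mul_eq_mul_div, div_le_iff₀ (by positivity)]
  unfold jap
  nlinarith [abs_nonneg γ, mul_le_mul_of_nonneg_right h1 (by positivity : 0 ≤ 1 + |γ|)]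

/-- A nonzero integer has absolute value at least half its bracket. -/
theorem jap_le_two_mul_abs {n : ℤ} (hn : n ≠ 0) : jap n ≤ 2 * |(n : ℝ)| := by
  have h : (1 : ℝ) ≤ |(n : ℝ)| := by exact_mod_cast Int.one_le_abs hn
  unfold jap
  linarith

/-- In the unbalanced region, two of the pairwise sums are comparable to the top frequency. -/
theorem memD2.two_sums_large {k₁ k₂ k₃ : ℤ} (h : memD2 k₁ k₂ k₃) :
    (max |k₁| (max |k₂| |k₃|) ≤ 8 * |k₁ + k₂| ∧ max |k₁| (max |k₂| |k₃|) ≤ 8 * |k₂ + k₃|) ∨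
    (max |k₁| (max |k₂| |k₃|) ≤ 8 * |k₁ + k₂| ∧ max |k₁| (max |k₂| |k₃|) ≤ 8 * |k₁ + k₃|) ∨
    (max |k₁| (max |k₂| |k₃|) ≤ 8 * |k₁ + k₃| ∧ max |k₁| (max |k₂| |k₃|) ≤ 8 * |k₂ + k₃|) := by
  have h' := h.2
  simp only [max_le_iff]
  have := le_abs_self (k₁ + k₂)
  have := neg_le_abs (k₁ + k₂)
  have := le_abs_self (k₂ + k₃)
  have := neg_le_abs (k₂ + k₃)
  have := le_abs_self (k₁ + k₃)
  have := neg_le_abs (k₁ + k₃)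
  rcases abs_cases k₁ with h₁ | h₁ <;> rcases abs_cases k₂ with h₂ | h₂ <;>
    rcases abs_cases k₃ with h₃ | h₃ <;> omega

/-- Refined upper bound on `|Φ|⁻¹` in `D₂(k)` (used in Lemma 3.2 / `lem:multilinear'`). -/
theorem stmt15 (α₁ α₂ : ℝ) (hα₁ : α₁ ≠ 0)
    (hres : ∀ n : ℤ, 2 * α₂ / (3 * α₁) ≠ (n : ℝ)) :
    ∃ C : ℝ, 0 < C ∧
      ∀ k₁ k₂ k₃ : ℤ, memD2 k₁ k₂ k₃ →
        |resPhi α₁ α₂ k₁ k₂ k₃|⁻¹ ≤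
          C * (max (jap (k₁ : ℝ)) (max (jap (k₂ : ℝ)) (jap (k₃ : ℝ))) ^ 2)⁻¹ *
            ((jap ((k₁ : ℝ) + k₂))⁻¹ + (jap ((k₁ : ℝ) + k₃))⁻¹ + (jap ((k₂ : ℝ) + k₃))⁻¹) := by
  obtain ⟨δ, hδ, hδ_le⟩ := exists_mul_jap_le_abs_add hres
  have hα : 0 < |α₁| := abs_pos.mpr hα₁
  refine ⟨256 / (3 * |α₁| * δ), by positivity, fun k₁ k₂ k₃ hk => ?_⟩
  have hne := mul_ne_zero_iff.mp hk.1
  have hA := jap_le_two_mul_abs hne.1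
  have hB := jap_le_two_mul_abs hne.2
  have hC := hδ_le (k₁ + k₃)
  push_cast at hA hB hC
  have hmax : max (jap (k₁ : ℝ)) (max (jap (k₂ : ℝ)) (jap (k₃ : ℝ))) =
      1 + ((max |k₁| (max |k₂| |k₃|) : ℤ) : ℝ) := by
    unfold jap
    push_cast
    rw [max_add_add_left, max_add_add_left]
  have hm0 : (0 : ℝ) ≤ ((max |k₁| (max |k₂| |k₃|) : ℤ) : ℝ) := by
    exact_mod_cast (abs_nonneg k₁).trans (le_max_left _ _)
  have hlarge := hk.two_sums_large
  rw [hmax]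
  generalize max |k₁| (max |k₂| |k₃|) = m at *
  have hjap : ∀ n : ℤ, m ≤ 8 * |n| → 1 + (m : ℝ) ≤ 8 * jap n := by
    intro n hn
    have hn' : (m : ℝ) ≤ 8 * |(n : ℝ)| := by exact_mod_cast hn
    unfold jap
    linarith
  have hA' := hjap (k₁ + k₂)
  have hB' := hjap (k₂ + k₃)
  have hC' := hjap (k₁ + k₃)
  push_cast at hA' hB' hC'
  have hA0 := jap_pos ((k₁ : ℝ) + k₂)
  have hB0 := jap_pos ((k₂ : ℝ) + k₃)
  have hC0 := jap_pos ((k₁ : ℝ) + k₃)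
  rw [resPhi_eq_mul α₂ hα₁]
  simp only [abs_mul, Nat.abs_ofNat]
  generalize jap ((k₁ : ℝ) + k₂) = A at *
  generalize jap ((k₂ : ℝ) + k₃) = B at *
  generalize jap ((k₁ : ℝ) + k₃) = C at *
  have hsq : (1 + (m : ℝ)) ^ 2 ≤ 64 * (A * B + B * C + A * C) := by
    have key : ∀ x y : ℝ, 1 + (m : ℝ) ≤ 8 * x → 1 + (m : ℝ) ≤ 8 * y →
        (1 + (m : ℝ)) ^ 2 ≤ 64 * (x * y) := by
      intro x y hx hy
      have := mul_le_mul hx hy (by linarith) (by linarith)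
      linarith
    have hAB := mul_pos hA0 hB0
    have hBC := mul_pos hB0 hC0
    have hAC := mul_pos hA0 hC0
    rcases hlarge with ⟨h, h'⟩ | ⟨h, h'⟩ | ⟨h, h'⟩
    · linarith [key A B (hA' h) (hB' h')]
    · linarith [key A C (hA' h) (hC' h')]
    · linarith [key B C (hB' h') (hC' h)]
  have hlow : 3 * |α₁| * (A / 2) * (B / 2) * (δ * C) ≤
      3 * |α₁| * |(k₁ : ℝ) + k₂| * |(k₂ : ℝ) + k₃| *
        |(k₁ : ℝ) + k₃ + 2 * α₂ / (3 * α₁)| := by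
    gcongr <;> linarith
  calc _ ≤ (3 * |α₁| * (A / 2) * (B / 2) * (δ * C))⁻¹ := by gcongr
    _ = 4 / (3 * |α₁| * δ * (A * B * C)) * ((1 + (m : ℝ)) ^ 2 * ((1 + (m : ℝ)) ^ 2)⁻¹) := by
      field_simp
      norm_num
    _ ≤ 4 / (3 * |α₁| * δ * (A * B * C)) *
        (64 * (A * B + B * C + A * C) * ((1 + (m : ℝ)) ^ 2)⁻¹) := by gcongr
    _ = _ := by
      field_simp
      ring
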